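/- Let X be a 0-distributive bounded G-lattice, n ≥ 1, and A ⊆ X a finite subset with |A| ≤ n and ⋁A = ⊤. Then there exists a ∈ A with cov(Δ(a)) ≤ s₋∞(n) in ℕ∞; consequently p_X(a) ≥ 1/s₋∞(n) and Σ_{b∈A} p_X(b) ≥ 1/s₋∞(n) (as real numbers, s₋∞(n) being finite). -/

import Mathlib

/-- `G = F·D`: every element of `G` is a product `f * d` with `f ∈ F`, `d ∈ D`. -/
def Covers {G : Type*} [Group G] (F D : Set G) : Prop :=
  ∀ g : G, ∃ f ∈ F, ∃ d ∈ D, g = f * d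

/-- The difference set `Δ(a) = {g ∈ G : (g • a) ⊓ a ≠ ⊥}`. -/
def deltaSet (G : Type*) [Group G] {X : Type*} [Lattice X] [BoundedOrder X]
    [MulAction G X] (a : X) : Set G :=
  {g : G | (g • a) ⊓ a ≠ ⊥}

/-- The covering number of `D ⊆ G`: the least cardinality of a finite `F ⊆ G`
with `G = F·D`, and `⊤` if no such finite `F` exists. -/
noncomputable def covNum (G : Type*) [Group G] (D : Set G) : ℕ∞ :=
  sInf {c : ℕ∞ | ∃ F : Finset G, (F.card : ℕ∞) = c ∧ Covers (↑F : Set G) D}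

/-- The Protasov density `p_X(a)`. -/
noncomputable def protasov (G : Type*) [Group G] {X : Type*} [Lattice X] [BoundedOrder X]
    [MulAction G X] (a : X) : ℝ :=
  if 0 < covNum G (deltaSet G a) ∧ covNum G (deltaSet G a) < ⊤ then
    1 / ((covNum G (deltaSet G a)).toNat : ℝ)
  else 0

/-- The indicator function `1_i : Fin n → ℕ` of `{i}`. -/
def oneAt {n : ℕ} (i : Fin n) : Fin n → ℕ := fun j => if j = i then 1 else 0

/-- Pointwise sumset `Σ_{j ∈ Fin n} A j` of a family of sets of functions. -/
def sumset {n : ℕ} (A : Fin n → Set (Fin n → ℕ)) : Set (Fin n → ℕ) :=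
  {x | ∃ a : Fin n → Fin n → ℕ, (∀ j, a j ∈ A j) ∧ x = ∑ j, a j}

/-- The strict lower cone `↓ℏ`. -/
def lowerCone {n : ℕ} (h : Fin n → ℕ) : Set (Fin n → ℕ) :=
  {g | ∀ i, g i < h i}

/-- One step of the generation process: `{x - x(i)·1_i : x ∈ ↓ℏ ∩ Σ_j B j}`. -/
def genStep {n : ℕ} (h : Fin n → ℕ) (B : Fin n → Set (Fin n → ℕ)) (i : Fin n) :
    Set (Fin n → ℕ) :=
  {y | ∃ x ∈ lowerCone h ∩ sumset B, y = x - x i • oneAt i}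

/-- The sets `ℏ^{[m]}(i)`. -/
def bracketSet {n : ℕ} (h : Fin n → ℕ) : ℕ → Fin n → Set (Fin n → ℕ)
  | 0 => fun i => {oneAt i}
  | m + 1 => fun i => genStep h (bracketSet h m) i ∪ bracketSet h m i

/-- The sets `ℏ^{⦃m⦄}(i)`. -/
def braceSet {n : ℕ} (h : Fin n → ℕ) : ℕ → Fin n → Set (Fin n → ℕ)
  | 0 => fun i => {oneAt i}
  | m + 1 => genStep h (bracketSet h m)

/-- `ℏ` is `0`-generating if the zero function belongs to `⋃_{i} ⋃_{m} ℏ^{⦃m⦄}(i)`. -/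
def IsZeroGenerating {n : ℕ} (h : Fin n → ℕ) : Prop :=
  ∃ i : Fin n, ∃ m : ℕ, (0 : Fin n → ℕ) ∈ braceSet h m i

/-- `s₋∞(n)`: the supremum of `min_i ℏ(i)` over non-`0`-generating `ℏ : Fin n → ℕ`. -/
noncomputable def sMinusInfty (n : ℕ) : ℕ∞ :=
  ⨆ (h : Fin n → ℕ) (_ : ¬ IsZeroGenerating h), ⨅ i, (h i : ℕ∞)

/-! ### Finiteness of `sMinusInfty` -/

theorem oneAt_mem_bracketSet {n : ℕ} (h : Fin n → ℕ) (m : ℕ) (i : Fin n) :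
    oneAt i ∈ bracketSet h m i := by
  induction m with
  | zero => exact rfl
  | succ m ih => exact Or.inr ih

/-- If every `B j` contains a function bounded by `c` and vanishing on `S`, then one generation
step at `i` produces a function bounded by `n * c` and vanishing on `S` and at `i`. -/
theorem exists_mem_genStep {n : ℕ} {h : Fin n → ℕ} {B : Fin n → Set (Fin n → ℕ)} {c : ℕ}
    (hc : ∀ j, n * c < h j) (S : Finset (Fin n))
    (hB : ∀ j, ∃ f ∈ B j, (∀ l ∈ S, f l = 0) ∧ ∀ l, f l ≤ c) (i : Fin n) :
    ∃ f ∈ genStep h B i, (∀ l ∈ S, f l = 0) ∧ f i = 0 ∧ ∀ l, f l ≤ n * c := by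
  choose f hfB hfS hfc using hB
  have hsum : ∀ l, (∑ j, f j) l ≤ n * c := fun l => by
    rw [Finset.sum_apply]
    calc ∑ j, f j l ≤ ∑ _j : Fin n, c := Finset.sum_le_sum fun j _ => hfc j l
      _ = n * c := by simp
  refine ⟨_, ⟨∑ j, f j, ⟨fun l => (hsum l).trans_lt (hc l), f, hfB, rfl⟩, rfl⟩, ?_, ?_, ?_⟩
  · intro l hl
    have h0 : (∑ j, f j) l = 0 := by
      rw [Finset.sum_apply]
      exact Finset.sum_eq_zero fun j _ => hfS j l hl
    rw [Pi.sub_apply, h0, Nat.zero_sub]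
  · simp [oneAt]
  · exact fun l => (Nat.sub_le _ _).trans (hsum l)

theorem exists_mem_bracketSet {n : ℕ} {h : Fin n → ℕ} (hn : 1 ≤ n) (hh : ∀ j, n ^ n < h j)
    (k : ℕ) (hk : k ≤ n) (S : Finset (Fin n)) (hS : S.card = k) (i : Fin n) :
    ∃ f ∈ bracketSet h k i, (∀ l ∈ S, f l = 0) ∧ ∀ l, f l ≤ n ^ k := by
  induction k generalizing S i with
  | zero =>
    obtain rfl := Finset.card_eq_zero.1 hS
    refine ⟨oneAt i, rfl, by simp, fun l => ?_⟩
    unfold oneAt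
    split_ifs <;> simp
  | succ k ih =>
    by_cases hi : i ∈ S
    · have hpow : ∀ j, n * n ^ k < h j := fun j => by
        rw [← pow_succ']
        exact (Nat.pow_le_pow_right hn hk).trans_lt (hh j)
      obtain ⟨f, hf, hfS, hfi, hfc⟩ := exists_mem_genStep hpow (S.erase i)
        (ih (by omega) _ (by rw [Finset.card_erase_of_mem hi, hS]; rfl)) i
      refine ⟨f, Or.inl hf, fun l hl => ?_, fun l => (hfc l).trans_eq (pow_succ' n k).symm⟩
      by_cases hli : l = i
      · rw [hli, hfi]
      · exact hfS l (Finset.mem_erase.2 ⟨hli, hl⟩)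
    · refine ⟨oneAt i, oneAt_mem_bracketSet h _ i, fun l hl => ?_, fun l => ?_⟩
      · exact if_neg fun hli : l = i => hi (hli ▸ hl)
      · have := Nat.one_le_pow (k + 1) n hn
        unfold oneAt
        split_ifs <;> omega

theorem isZeroGenerating_of_lt {n : ℕ} {h : Fin n → ℕ} (hn : 1 ≤ n) (hh : ∀ j, n ^ n < h j) :
    IsZeroGenerating h := by
  obtain ⟨k, rfl⟩ : ∃ k, n = k + 1 := ⟨n - 1, by omega⟩
  let i : Fin (k + 1) := 0
  obtain ⟨f, hf, hfS, hfi, -⟩ := exists_mem_genStep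
    (fun j => by rw [← pow_succ']; exact hh j) (Finset.univ.erase i)
    (exists_mem_bracketSet hn hh k k.le_succ (Finset.univ.erase i) (by simp)) i
  have h0 : f = 0 := by
    funext l
    by_cases hli : l = i
    · rw [hli, hfi]; rfl
    · exact hfS l (by simpa using hli)
  exact ⟨i, k + 1, h0 ▸ hf⟩

theorem sMinusInfty_le_pow {n : ℕ} (hn : 1 ≤ n) : sMinusInfty n ≤ (n ^ n : ℕ) := by
  refine iSup₂_le fun h hh => ?_
  by_contra! hlt
  exact hh (isZeroGenerating_of_lt hn fun j => by
    exact_mod_cast hlt.trans_le (iInf_le _ j))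

/-! ### Covering numbers -/

theorem covNum_le_card {G : Type*} [Group G] {D : Set G} (F : Finset G)
    (hF : Covers (F : Set G) D) : covNum G D ≤ F.card :=
  sInf_le ⟨F, rfl, hF⟩

theorem covNum_pos {G : Type*} [Group G] (D : Set G) : 0 < covNum G D := by
  refine lt_of_lt_of_le zero_lt_one (le_sInf ?_)
  rintro _ ⟨F, rfl, hF⟩
  obtain ⟨f, hf, -⟩ := hF 1
  exact_mod_cast Finset.card_pos.2 ⟨f, hf⟩

theorem protasov_nonneg (G : Type*) [Group G] {X : Type*} [Lattice X] [BoundedOrder X]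
    [MulAction G X] (a : X) : 0 ≤ protasov G a := by
  unfold protasov
  split_ifs <;> positivity

theorem one_div_le_protasov {G : Type*} [Group G] {X : Type*} [Lattice X] [BoundedOrder X]
    [MulAction G X] {a : X} {s : ℕ∞} (hs : s ≠ ⊤) (h : covNum G (deltaSet G a) ≤ s) :
    1 / (s.toNat : ℝ) ≤ protasov G a := by
  have hpos := covNum_pos (deltaSet G a)
  have hlt := h.trans_lt hs.lt_top
  rw [protasov, if_pos ⟨hpos, hlt⟩]
  have h0 : 0 < (covNum G (deltaSet G a)).toNat := by
    rw [Nat.pos_iff_ne_zero, Ne, ENat.toNat_eq_zero]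
    exact not_or.2 ⟨hpos.ne', hlt.ne⟩
  exact one_div_le_one_div_of_le (by exact_mod_cast h0)
    (by exact_mod_cast ENat.toNat_le_toNat h hs)

/-! ### Domination by translates -/

/-- `x` lies below every upper bound of some family consisting, for each `j`, of at most `f j`
translates of `a j`. -/
def DominatedBy (G : Type*) [Group G] {X : Type*} [Lattice X] [MulAction G X] {n : ℕ}
    (a : Fin n → X) (f : Fin n → ℕ) (x : X) : Prop :=
  ∃ F : Fin n → Finset G, (∀ j, (F j).card ≤ f j) ∧
    ∀ u : X, (∀ j, ∀ g ∈ F j, g • a j ≤ u) → x ≤ u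

section Lattice

variable {G : Type*} [Group G] {X : Type*} [Lattice X] [MulAction G X]

theorem smul_le_smul_of_map_sup (hsup : ∀ (g : G) (x y : X), g • (x ⊔ y) = g • x ⊔ g • y)
    (g : G) {x y : X} (h : x ≤ y) : g • x ≤ g • y := by
  rw [← sup_eq_right, ← hsup, sup_eq_right.2 h]

theorem smul_le_iff_of_map_sup (hsup : ∀ (g : G) (x y : X), g • (x ⊔ y) = g • x ⊔ g • y)
    (g : G) {x y : X} : g • x ≤ y ↔ x ≤ g⁻¹ • y :=
  ⟨fun h => by simpa using smul_le_smul_of_map_sup hsup g⁻¹ h,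
    fun h => by simpa using smul_le_smul_of_map_sup hsup g h⟩

theorem dominatedBy_oneAt {n : ℕ} (a : Fin n → X) (i : Fin n) :
    DominatedBy G a (oneAt i) (a i) := by
  refine ⟨fun j => if j = i then {1} else ∅, fun j => ?_, fun u hu => ?_⟩
  · by_cases hj : j = i <;> simp [oneAt, hj]
  · simpa using hu i 1 (by simp)

variable [BoundedOrder X]

theorem smul_bot_of_map_sup (hsup : ∀ (g : G) (x y : X), g • (x ⊔ y) = g • x ⊔ g • y)
    (g : G) : g • (⊥ : X) = ⊥ :=
  le_bot_iff.1 ((smul_le_iff_of_map_sup hsup g).2 bot_le)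

theorem inf_finset_sup_eq_bot {X : Type*} [Lattice X] [BoundedOrder X]
    (h0dist : ∀ x y z : X, x ⊓ y = ⊥ → x ⊓ (y ⊔ z) = x ⊓ z)
    {ι : Type*} (s : Finset ι) (b : ι → X) (x : X) (h : ∀ i ∈ s, x ⊓ b i = ⊥) :
    x ⊓ s.sup b = ⊥ := by
  classical
  induction s using Finset.induction_on with
  | empty => simp
  | insert i s _ ih =>
    rw [Finset.sup_insert, h0dist _ _ _ (h i (Finset.mem_insert_self i s))]
    exact ih fun j hj => h j (Finset.mem_insert_of_mem hj)

theorem dominatedBy_top_of_mem_sumset {n : ℕ} {a : Fin n → X}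
    (htop : ∀ u, (∀ i, a i ≤ u) → u = ⊤) {B : Fin n → Set (Fin n → ℕ)}
    (hB : ∀ i, ∀ f ∈ B i, DominatedBy G a f (a i)) {x : Fin n → ℕ} (hx : x ∈ sumset B) :
    DominatedBy G a x (⊤ : X) := by
  classical
  obtain ⟨f, hf, rfl⟩ := hx
  choose F hFcard hF using fun i => hB i (f i) (hf i)
  refine ⟨fun j => Finset.univ.biUnion fun i => F i j, fun j => ?_, fun u hu => ?_⟩
  · rw [Finset.sum_apply]
    exact Finset.card_biUnion_le.trans (Finset.sum_le_sum fun i _ => hFcard i j)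
  · exact (htop u fun i => hF i u fun j g hg =>
      hu j g (Finset.mem_biUnion.2 ⟨i, Finset.mem_univ i, hg⟩)).ge

/-- Fewer than `cov(Δ(a i))` translates of `a i` miss some further translate of `a i`, so they can
be removed from a family with join `⊤`, at the price of dominating only `a i`. -/
theorem DominatedBy.remove
    (hsup : ∀ (g : G) (x y : X), g • (x ⊔ y) = g • x ⊔ g • y)
    (hinf : ∀ (g : G) (x y : X), g • (x ⊓ y) = g • x ⊓ g • y)
    (h0dist : ∀ x y z : X, x ⊓ y = ⊥ → x ⊓ (y ⊔ z) = x ⊓ z)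
    {n : ℕ} {a : Fin n → X} {x : Fin n → ℕ} (hx : DominatedBy G a x (⊤ : X)) {i : Fin n}
    (hi : (x i : ℕ∞) < covNum G (deltaSet G (a i))) :
    DominatedBy G a (x - x i • oneAt i) (a i) := by
  classical
  obtain ⟨F, hFcard, hF⟩ := hx
  obtain ⟨g, hg⟩ : ∃ g : G, ∀ f ∈ F i, g • a i ⊓ f • a i = ⊥ := by
    by_contra! hcon
    refine hi.not_ge ((covNum_le_card (F i) fun g => ?_).trans (by exact_mod_cast hFcard i))
    obtain ⟨f, hf, hne⟩ := hcon g
    refine ⟨f, hf, f⁻¹ * g, fun h => hne ?_, by group⟩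
    have := congrArg (f • ·) h
    simpa [hinf, mul_smul, smul_bot_of_map_sup hsup] using this
  refine ⟨fun j => if j = i then ∅ else (F j).image (g⁻¹ * ·), fun j => ?_, fun u hu => ?_⟩
  · by_cases hj : j = i
    · simp [hj]
    · have hcard : ((F j).image (g⁻¹ * ·)).card ≤ x j := Finset.card_image_le.trans (hFcard j)
      simpa [hj, oneAt] using hcard
  · set w := (F i).sup fun f => f • a i
    have hw : g • a i ⊓ w = ⊥ := inf_finset_sup_eq_bot h0dist _ _ _ hg
    have htop : w ⊔ g • u = ⊤ := by
      refine top_le_iff.1 (hF _ fun j f hf => ?_)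
      by_cases hj : j = i
      · subst hj
        exact (Finset.le_sup (f := fun f => f • a j) hf).trans le_sup_left
      · have := hu j (g⁻¹ * f) (by simpa [hj] using hf)
        rw [mul_smul, smul_le_iff_of_map_sup hsup, inv_inv] at this
        exact this.trans le_sup_right
    have hle : g • a i ≤ g • u := by
      rw [← inf_eq_left, ← h0dist _ _ _ hw, htop, inf_top_eq]
    simpa using smul_le_smul_of_map_sup hsup g⁻¹ hle

theorem not_isZeroGenerating_of_le_covNum
    (hsup : ∀ (g : G) (x y : X), g • (x ⊔ y) = g • x ⊔ g • y)
    (hinf : ∀ (g : G) (x y : X), g • (x ⊓ y) = g • x ⊓ g • y)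
    (h0dist : ∀ x y z : X, x ⊓ y = ⊥ → x ⊓ (y ⊔ z) = x ⊓ z)
    {n : ℕ} {a : Fin n → X} (htop : ∀ u, (∀ i, a i ≤ u) → u = ⊤) (ha : ∀ i, a i ≠ ⊥)
    {h : Fin n → ℕ} (hh : ∀ i, (h i : ℕ∞) ≤ covNum G (deltaSet G (a i))) :
    ¬ IsZeroGenerating h := by
  have hstep : ∀ B : Fin n → Set (Fin n → ℕ), (∀ i, ∀ f ∈ B i, DominatedBy G a f (a i)) →
      ∀ i, ∀ f ∈ genStep h B i, DominatedBy G a f (a i) := by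
    rintro B hB i _ ⟨x, ⟨hxh, hxB⟩, rfl⟩
    exact (dominatedBy_top_of_mem_sumset htop hB hxB).remove hsup hinf h0dist
      ((Nat.cast_lt.2 (hxh i)).trans_le (hh i))
  have hbracket : ∀ m i, ∀ f ∈ bracketSet h m i, DominatedBy G a f (a i) := by
    intro m
    induction m with
    | zero =>
      rintro i _ rfl
      exact dominatedBy_oneAt a i
    | succ m ih =>
      rintro i f (hf | hf)
      · exact hstep _ ih i f hf
      · exact ih i f hf
  rintro ⟨i, m, hm⟩
  have hdom : DominatedBy G a 0 (a i) := by
    cases m with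
    | zero =>
      exact hbracket 0 i _ hm
    | succ m => exact hstep _ (hbracket m) i _ hm
  obtain ⟨F, hF, hle⟩ := hdom
  refine ha i (le_bot_iff.1 (hle ⊥ fun j g hg => ?_))
  have : F j = ∅ := Finset.card_eq_zero.1 (Nat.le_zero.1 (hF j))
  simp [this] at hg

end Lattice

/-- A nonempty finite set with at most `n` elements is the range of a function on `Fin n`. -/
theorem Finset.exists_fin_range_eq {α : Type*} (s : Finset α) (hs : s.Nonempty) {n : ℕ}
    (hn : s.card ≤ n) : ∃ a : Fin n → α, Set.range a = s := by
  have : Nonempty s := hs.to_subtype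
  obtain ⟨e⟩ : Nonempty (s ↪ Fin n) := Function.Embedding.nonempty_of_card_le (by simpa using hn)
  refine ⟨fun i => (Function.invFun e i : s), ?_⟩
  rw [← Function.comp_def, Set.range_comp, (Function.invFun_surjective e.injective).range_eq]
  simp

/-- In a `0`-distributive bounded `G`-lattice, for every finite `A ⊆ X` with `|A| ≤ n`
and `⋁A = ⊤` there is `a ∈ A` with `cov(Δ(a)) ≤ s₋∞(n)`; consequently (as `s₋∞(n)` is
finite) `p_X(a) ≥ 1/s₋∞(n)` and `Σ_{b ∈ A} p_X(b) ≥ 1/s₋∞(n)`. -/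
theorem cov_le_sMinusInfty
    {G : Type*} [Group G] {X : Type*} [Lattice X] [BoundedOrder X] [MulAction G X]
    (hbt : (⊥ : X) ≠ ⊤)
    (hsup : ∀ (g : G) (x y : X), g • (x ⊔ y) = g • x ⊔ g • y)
    (hinf : ∀ (g : G) (x y : X), g • (x ⊓ y) = g • x ⊓ g • y)
    (h0dist : ∀ x y z : X, x ⊓ y = ⊥ → x ⊓ (y ⊔ z) = x ⊓ z)
    (n : ℕ) (hn : 1 ≤ n) (A : Finset X) (hcard : A.card ≤ n) (hA : A.sup id = ⊤) :
    sMinusInfty n ≠ ⊤ ∧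
    ∃ a ∈ A, covNum G (deltaSet G a) ≤ sMinusInfty n ∧
      1 / (((sMinusInfty n).toNat : ℝ)) ≤ protasov G a ∧
      1 / (((sMinusInfty n).toNat : ℝ)) ≤ ∑ b ∈ A, protasov G b := by
  classical
  have hfin : sMinusInfty n ≠ ⊤ :=
    ((sMinusInfty_le_pow hn).trans_lt (ENat.natCast_lt_top _)).ne
  suffices h : ∃ a ∈ A, covNum G (deltaSet G a) ≤ sMinusInfty n by
    obtain ⟨a, ha, hcov⟩ := h
    have hp := one_div_le_protasov hfin hcov
    exact ⟨hfin, a, ha, hcov, hp,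
      hp.trans (Finset.single_le_sum (fun b _ => protasov_nonneg G b) ha)⟩
  by_contra! hcon
  have hne : (A.filter (· ≠ ⊥)).Nonempty := by
    by_contra hempty
    rw [Finset.not_nonempty_iff_eq_empty, Finset.filter_eq_empty_iff] at hempty
    refine hbt (hA ▸ (Finset.sup_eq_bot_iff _ _).2 fun x hx => ?_).symm
    simpa using hempty hx
  obtain ⟨a, ha⟩ := (A.filter (· ≠ ⊥)).exists_fin_range_eq hne
    ((Finset.card_filter_le _ _).trans hcard)
  have hmem : ∀ i, a i ∈ A ∧ a i ≠ ⊥ := fun i => by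
    have : a i ∈ (A.filter (· ≠ ⊥) : Set X) := ha ▸ Set.mem_range_self i
    simpa using this
  have htop : ∀ u, (∀ i, a i ≤ u) → u = ⊤ := by
    refine fun u hu => top_le_iff.1 (hA ▸ Finset.sup_le fun x hx => ?_)
    by_cases hx0 : x = ⊥
    · simp [hx0]
    · have : x ∈ Set.range a := by
        rw [ha]
        simpa using ⟨hx, hx0⟩
      obtain ⟨i, rfl⟩ := this
      exact hu i
  lift sMinusInfty n to ℕ using hfin with s hs
  have hgen := not_isZeroGenerating_of_le_covNum hsup hinf h0dist htop (fun i => (hmem i).2)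
    (h := fun _ => s + 1) fun i => by
      push_cast
      exact Order.add_one_le_of_lt (hcon _ (hmem i).1)
  have : Nonempty (Fin n) := ⟨⟨0, hn⟩⟩
  have hle : (⨅ _i : Fin n, ((s + 1 : ℕ) : ℕ∞)) ≤ sMinusInfty n :=
    le_iSup₂ (f := fun (h : Fin n → ℕ) (_ : ¬ IsZeroGenerating h) => ⨅ i, (h i : ℕ∞)) _ hgen
  rw [ciInf_const, ← hs, Nat.cast_le] at hle
  omega
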